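/- Value stability: if v is a value with derivable program typing Γ; Δ ⊢ v : A and derivable logical typing Γ ⊢ A : s, then the context constraint Δ ▷ s holds. -/

import Mathlib

namespace TLL

/-- The two sorts of TLL: `U` (non-linear) and `L` (linear). -/
inductive Srt : Type
  | U | L
deriving DecidableEq

/-- TLL terms in de Bruijn representation: variables, sorts, the two Π-type
formers (irrelevant `pi0` and relevant `pi1`), the two λ-formers, application,
the erased constant `box`, and heap pointers `ptr`. -/
inductive Tm : Type
  | var  : Nat → Tm
  | srt  : Srt → Tm
  | pi0  : Srt → Tm → Tm → Tm
  | pi1  : Srt → Tm → Tm → Tm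
  | lam0 : Srt → Tm → Tm → Tm
  | lam1 : Srt → Tm → Tm → Tm
  | app  : Tm → Tm → Tm
  | box  : Tm
  | ptr  : Nat → Tm

def upr (ξ : Nat → Nat) : Nat → Nat
  | 0 => 0
  | n + 1 => ξ n + 1

def rename (ξ : Nat → Nat) : Tm → Tm
  | .var x => .var (ξ x)
  | .srt s => .srt s
  | .pi0 t A B => .pi0 t (rename ξ A) (rename (upr ξ) B)
  | .pi1 t A B => .pi1 t (rename ξ A) (rename (upr ξ) B)
  | .lam0 t A m => .lam0 t (rename ξ A) (rename (upr ξ) m)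
  | .lam1 t A m => .lam1 t (rename ξ A) (rename (upr ξ) m)
  | .app m n => .app (rename ξ m) (rename ξ n)
  | .box => .box
  | .ptr l => .ptr l

def up (σ : Nat → Tm) : Nat → Tm
  | 0 => .var 0
  | n + 1 => rename Nat.succ (σ n)

def subst (σ : Nat → Tm) : Tm → Tm
  | .var x => σ x
  | .srt s => .srt s
  | .pi0 t A B => .pi0 t (subst σ A) (subst (up σ) B)
  | .pi1 t A B => .pi1 t (subst σ A) (subst (up σ) B)
  | .lam0 t A m => .lam0 t (subst σ A) (subst (up σ) m)
  | .lam1 t A m => .lam1 t (subst σ A) (subst (up σ) m)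
  | .app m n => .app (subst σ m) (subst σ n)
  | .box => .box
  | .ptr l => .ptr l

/-- `subst1 n m` is `m[n/x]` for the topmost bound variable `x`. -/
def subst1 (n : Tm) (m : Tm) : Tm :=
  subst (fun i => match i with | 0 => n | i + 1 => .var i) m

/-- Logical one-step reduction `m ~> n`: full β-reduction with both β-rules,
closed under all structural subterm positions. -/
inductive LStep : Tm → Tm → Prop
  | beta0 {t A m n} : LStep (.app (.lam0 t A m) n) (subst1 n m)
  | beta1 {t A m n} : LStep (.app (.lam1 t A m) n) (subst1 n m)
  | appL {m m' n} : LStep m m' → LStep (.app m n) (.app m' n)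
  | appR {m n n'} : LStep n n' → LStep (.app m n) (.app m n')
  | pi0A {t A A' B} : LStep A A' → LStep (.pi0 t A B) (.pi0 t A' B)
  | pi0B {t A B B'} : LStep B B' → LStep (.pi0 t A B) (.pi0 t A B')
  | pi1A {t A A' B} : LStep A A' → LStep (.pi1 t A B) (.pi1 t A' B)
  | pi1B {t A B B'} : LStep B B' → LStep (.pi1 t A B) (.pi1 t A B')
  | lam0A {t A A' m} : LStep A A' → LStep (.lam0 t A m) (.lam0 t A' m)
  | lam0M {t A m m'} : LStep m m' → LStep (.lam0 t A m) (.lam0 t A m')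
  | lam1A {t A A' m} : LStep A A' → LStep (.lam1 t A m) (.lam1 t A' m)
  | lam1M {t A m m'} : LStep m m' → LStep (.lam1 t A m) (.lam1 t A m')

/-- Multi-step logical reduction. -/
abbrev LRed : Tm → Tm → Prop := Relation.ReflTransGen LStep

/-- Definitional equality `A ≃ B`: equivalence closure of logical reduction. -/
def Conv (A B : Tm) : Prop := Relation.EqvGen LStep A B

/-- Parallel logical reduction `m ⇒ n`. -/
inductive PStep : Tm → Tm → Prop
  | var {x} : PStep (.var x) (.var x)
  | srt {s} : PStep (.srt s) (.srt s)
  | box : PStep .box .box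
  | ptr {l} : PStep (.ptr l) (.ptr l)
  | pi0 {t A A' B B'} : PStep A A' → PStep B B' → PStep (.pi0 t A B) (.pi0 t A' B')
  | pi1 {t A A' B B'} : PStep A A' → PStep B B' → PStep (.pi1 t A B) (.pi1 t A' B')
  | lam0 {t A A' m m'} : PStep A A' → PStep m m' → PStep (.lam0 t A m) (.lam0 t A' m')
  | lam1 {t A A' m m'} : PStep A A' → PStep m m' → PStep (.lam1 t A m) (.lam1 t A' m')
  | app {m m' n n'} : PStep m m' → PStep n n' → PStep (.app m n) (.app m' n')
  | beta0 {t A m m' n n'} : PStep m m' → PStep n n' →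
      PStep (.app (.lam0 t A m) n) (subst1 n' m')
  | beta1 {t A m m' n n'} : PStep m m' → PStep n n' →
      PStep (.app (.lam1 t A m) n) (subst1 n' m')

/-- Logical contexts: lists of types (de Bruijn). -/
abbrev Ctx := List Tm

/-- `Has Γ x A`: variable `x` has type `A` in logical context `Γ`
(with the appropriate de Bruijn shifts). -/
inductive Has : Ctx → Nat → Tm → Prop
  | zero {Γ A} : Has (A :: Γ) 0 (rename Nat.succ A)
  | succ {Γ x A B} : Has Γ x A → Has (B :: Γ) (x + 1) (rename Nat.succ A)

mutual
/-- Well-formed logical contexts. -/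
inductive LWf : Ctx → Prop
  | nil : LWf []
  | cons {Γ A s} : LWf Γ → LTyped Γ A (.srt s) → LWf (A :: Γ)

/-- The logical typing judgment `Γ ⊢ m : A`. -/
inductive LTyped : Ctx → Tm → Tm → Prop
  | srt {Γ} (s : Srt) : LWf Γ → LTyped Γ (.srt s) (.srt .U)
  | var {Γ x A} : LWf Γ → Has Γ x A → LTyped Γ (.var x) A
  | pi0 {Γ A B s r} (t : Srt) :
      LTyped Γ A (.srt s) → LTyped (A :: Γ) B (.srt r) →
      LTyped Γ (.pi0 t A B) (.srt t)
  | pi1 {Γ A B s r} (t : Srt) :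
      LTyped Γ A (.srt s) → LTyped (A :: Γ) B (.srt r) →
      LTyped Γ (.pi1 t A B) (.srt t)
  | lam0 {Γ A B m} (t : Srt) :
      LTyped (A :: Γ) m B → LTyped Γ (.lam0 t A m) (.pi0 t A B)
  | lam1 {Γ A B m} (t : Srt) :
      LTyped (A :: Γ) m B → LTyped Γ (.lam1 t A m) (.pi1 t A B)
  | app0 {Γ m n A B t} :
      LTyped Γ m (.pi0 t A B) → LTyped Γ n A → LTyped Γ (.app m n) (subst1 n B)
  | app1 {Γ m n A B t} :
      LTyped Γ m (.pi1 t A B) → LTyped Γ n A → LTyped Γ (.app m n) (subst1 n B)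
  | conv {Γ m A B s} :
      LTyped Γ m A → LTyped Γ B (.srt s) → Conv A B → LTyped Γ m B
end

/-- Program context entries: either absent, or a sort-annotated type. -/
abbrev Entry := Option (Srt × Tm)

/-- Program contexts, positionally aligned with the logical context. -/
abbrev PCtx := List Entry

/-- The context constraint `Δ ▷ s`. -/
inductive Restr : PCtx → Srt → Prop
  | nil {s} : Restr [] s
  | skip {Δ s} : Restr Δ s → Restr ((none : Entry) :: Δ) s
  | u {Δ A} : Restr Δ .U → Restr (some (.U, A) :: Δ) .U
  | l {Δ s A} : Restr Δ .L → Restr (some (s, A) :: Δ) .L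

/-- Context merge `Δ₁ ∪̇ Δ₂ = Δ`: contraction on shared `U` entries,
`L` entries occur on exactly one side. -/
inductive Merge : PCtx → PCtx → PCtx → Prop
  | nil : Merge [] [] []
  | contra {Δ₁ Δ₂ Δ A} : Merge Δ₁ Δ₂ Δ →
      Merge (some (.U, A) :: Δ₁) (some (.U, A) :: Δ₂) (some (.U, A) :: Δ)
  | left {Δ₁ Δ₂ Δ A} : Merge Δ₁ Δ₂ Δ →
      Merge (some (.L, A) :: Δ₁) ((none : Entry) :: Δ₂) (some (.L, A) :: Δ)
  | right {Δ₁ Δ₂ Δ A} : Merge Δ₁ Δ₂ Δ →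
      Merge ((none : Entry) :: Δ₁) (some (.L, A) :: Δ₂) (some (.L, A) :: Δ)
  | skip {Δ₁ Δ₂ Δ} : Merge Δ₁ Δ₂ Δ →
      Merge ((none : Entry) :: Δ₁) ((none : Entry) :: Δ₂) ((none : Entry) :: Δ)

/-- `PHas Δ x s A`: the entry `x :s A` occurs in `Δ` and the rest of `Δ`
satisfies `▷ U` (so no linear entry is discarded). -/
inductive PHas : PCtx → Nat → Srt → Tm → Prop
  | zero {Δ s A} : Restr Δ .U → PHas (some (s, A) :: Δ) 0 s (rename Nat.succ A)
  | succN {Δ x s A} : PHas Δ x s A → PHas ((none : Entry) :: Δ) (x + 1) s (rename Nat.succ A)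
  | succU {Δ x s A B} : PHas Δ x s A → PHas (some (.U, B) :: Δ) (x + 1) s (rename Nat.succ A)

/-- Well-formed pairs of logical and program contexts `Γ ; Δ ⊢`. -/
inductive PWf : Ctx → PCtx → Prop
  | nil : PWf [] []
  | cons {Γ Δ A s} : PWf Γ Δ → LTyped Γ A (.srt s) → PWf (A :: Γ) (some (s, A) :: Δ)
  | consN {Γ Δ A s} : PWf Γ Δ → LTyped Γ A (.srt s) → PWf (A :: Γ) ((none : Entry) :: Δ)

/-- The program typing judgment `Γ ; Δ ⊢ m : A`. -/
inductive PTyped : Ctx → PCtx → Tm → Tm → Prop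
  | var {Γ Δ x s A} : PWf Γ Δ → PHas Δ x s A → PTyped Γ Δ (.var x) A
  | lam0 {Γ Δ A B m} (t : Srt) :
      PTyped (A :: Γ) ((none : Entry) :: Δ) m B → Restr Δ t →
      PTyped Γ Δ (.lam0 t A m) (.pi0 t A B)
  | lam1 {Γ Δ A B m s} (t : Srt) :
      PTyped (A :: Γ) (some (s, A) :: Δ) m B → Restr Δ t →
      PTyped Γ Δ (.lam1 t A m) (.pi1 t A B)
  | app0 {Γ Δ m n A B t} :
      PTyped Γ Δ m (.pi0 t A B) → LTyped Γ n A →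
      PTyped Γ Δ (.app m n) (subst1 n B)
  | app1 {Γ Δ₁ Δ₂ Δ m n A B t} :
      PTyped Γ Δ₁ m (.pi1 t A B) → PTyped Γ Δ₂ n A → Merge Δ₁ Δ₂ Δ →
      PTyped Γ Δ (.app m n) (subst1 n B)
  | conv {Γ Δ m A B s} :
      PTyped Γ Δ m A → LTyped Γ B (.srt s) → Conv A B →
      PTyped Γ Δ m B

/-- Program values. -/
inductive Value : Tm → Prop
  | var {x} : Value (.var x)
  | lam0 {t A m} : Value (.lam0 t A m)
  | lam1 {t A m} : Value (.lam1 t A m)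

/-- Program (call-by-value) one-step reduction `m ~~> n`. -/
inductive CStep : Tm → Tm → Prop
  | appL {m m' n} : CStep m m' → CStep (.app m n) (.app m' n)
  | appR {m n n'} : CStep n n' → CStep (.app m n) (.app m n')
  | beta0 {t A m n} : CStep (.app (.lam0 t A m) n) (subst1 n m)
  | beta1 {t A m v} : Value v → CStep (.app (.lam1 t A m) v) (subst1 v m)

/-- The erasure judgment `Γ ; Δ ⊢ m ~ m' : A`. -/
inductive Erase : Ctx → PCtx → Tm → Tm → Tm → Prop
  | var {Γ Δ x s A} : PWf Γ Δ → PHas Δ x s A → Erase Γ Δ (.var x) (.var x) A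
  | lam0 {Γ Δ A B m m'} (t : Srt) :
      Erase (A :: Γ) ((none : Entry) :: Δ) m m' B → Restr Δ t →
      Erase Γ Δ (.lam0 t A m) (.lam0 t .box m') (.pi0 t A B)
  | lam1 {Γ Δ A B m m' s} (t : Srt) :
      Erase (A :: Γ) (some (s, A) :: Δ) m m' B → Restr Δ t →
      Erase Γ Δ (.lam1 t A m) (.lam1 t .box m') (.pi1 t A B)
  | app0 {Γ Δ m m' n A B t} :
      Erase Γ Δ m m' (.pi0 t A B) → LTyped Γ n A →
      Erase Γ Δ (.app m n) (.app m' .box) (subst1 n B)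
  | app1 {Γ Δ₁ Δ₂ Δ m m' n n' A B t} :
      Erase Γ Δ₁ m m' (.pi1 t A B) → Erase Γ Δ₂ n n' A → Merge Δ₁ Δ₂ Δ →
      Erase Γ Δ (.app m n) (.app m' n') (subst1 n B)
  | conv {Γ Δ m m' A B s} :
      Erase Γ Δ m m' A → LTyped Γ B (.srt s) → Conv A B →
      Erase Γ Δ m m' B

/-- Heaps: finite maps from locations to sort-annotated values. -/
abbrev Heap := Nat → Option (Srt × Tm)

/-- Heap lookup `Lookup H₁ l v H₂`: non-linear cells persist, linear cells
are deallocated. -/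
inductive Lookup : Heap → Nat → Tm → Heap → Prop
  | u {H l v} : H l = some (.U, v) → Lookup H l v H
  | l {H l v} : H l = some (.L, v) → Lookup H l v (Function.update H l none)

/-- Heap merge `H₁ ∪̇ H₂ = H`. -/
def HMerge (H₁ H₂ H : Heap) : Prop := ∀ l,
  (H₁ l = none ∧ H₂ l = none ∧ H l = none) ∨
  (∃ v, H₁ l = some (.U, v) ∧ H₂ l = some (.U, v) ∧ H l = some (.U, v)) ∨
  (∃ v, H₁ l = some (.L, v) ∧ H₂ l = none ∧ H l = some (.L, v)) ∨
  (∃ v, H₁ l = none ∧ H₂ l = some (.L, v) ∧ H l = some (.L, v))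

/-- The heap constraint `H ▷ s`. -/
def HRestr (H : Heap) : Srt → Prop
  | .U => ∀ l s v, H l = some (s, v) → s = Srt.U
  | .L => True

/-- Heap reduction `H ; m ~~> H' ; m'`. -/
inductive HStep : Heap → Tm → Heap → Tm → Prop
  | alloc0 {H l t m} : H l = none →
      HStep H (.lam0 t .box m) (Function.update H l (some (t, .lam0 t .box m))) (.ptr l)
  | alloc1 {H l t m} : H l = none →
      HStep H (.lam1 t .box m) (Function.update H l (some (t, .lam1 t .box m))) (.ptr l)
  | appL {H H' m m' n} : HStep H m H' m' → HStep H (.app m n) H' (.app m' n)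
  | appR {H H' m n n'} : HStep H n H' n' → HStep H (.app m n) H' (.app m n')
  | beta0 {H H' l t m n} : Lookup H l (.lam0 t .box m) H' →
      HStep H (.app (.ptr l) n) H' (subst1 .box m)
  | beta1 {H H' l₁ l₂ t m} : Lookup H l₁ (.lam1 t .box m) H' →
      HStep H (.app (.ptr l₁) (.ptr l₂)) H' (subst1 (.ptr l₂) m)

/-- Pointer resolution `H ; m ~ n`. -/
inductive Resolve : Heap → Tm → Tm → Prop
  | var {H x} : HRestr H .U → Resolve H (.var x) (.var x)
  | lam0 {H t m' m} : HRestr H t → Resolve H m' m →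
      Resolve H (.lam0 t .box m') (.lam0 t .box m)
  | lam1 {H t m' m} : HRestr H t → Resolve H m' m →
      Resolve H (.lam1 t .box m') (.lam1 t .box m)
  | app0 {H m' m} : Resolve H m' m → Resolve H (.app m' .box) (.app m .box)
  | app1 {H₁ H₂ H m' m n' n} : HMerge H₁ H₂ H →
      Resolve H₁ m' m → Resolve H₂ n' n → Resolve H (.app m' n') (.app m n)
  | ptr {H H' l v' v} : Lookup H l v' H' → Resolve H' v' v → Resolve H (.ptr l) v

/-- `ClosedUnder k m`: all free de Bruijn variables of `m` are `< k`. -/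
def ClosedUnder : Nat → Tm → Prop
  | k, .var x => x < k
  | _, .srt _ => True
  | k, .pi0 _ A B => ClosedUnder k A ∧ ClosedUnder (k + 1) B
  | k, .pi1 _ A B => ClosedUnder k A ∧ ClosedUnder (k + 1) B
  | k, .lam0 _ A m => ClosedUnder k A ∧ ClosedUnder (k + 1) m
  | k, .lam1 _ A m => ClosedUnder k A ∧ ClosedUnder (k + 1) m
  | k, .app m n => ClosedUnder k m ∧ ClosedUnder k n
  | _, .box => True
  | _, .ptr _ => True

/-- WR-heaps: heaps plausibly produced by heap reduction. -/
inductive WrHeap : Heap → Prop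
  | nil : WrHeap (fun _ => none)
  | lam0 {H l t m} : ClosedUnder 1 m → WrHeap H → H l = none →
      WrHeap (Function.update H l (some (t, .lam0 t .box m)))
  | lam1 {H l t m} : ClosedUnder 1 m → WrHeap H → H l = none →
      WrHeap (Function.update H l (some (t, .lam1 t .box m)))

/-- Well-resolved `H ⊢ a ~ b ~ c : A`. -/
def WellResolved (H : Heap) (a b c A : Tm) : Prop :=
  Erase [] [] a b A ∧ Resolve H c b


/-! The metatheory is developed for a calculus without relevance annotations, onto which
both the logical and the program judgments project. Its contexts carry no well-formedness
side conditions, which makes its typing judgment a plain (non-mutual) inductive. -/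

/-- Terms of TLL without relevance annotations, boxes and pointers being identified. -/
inductive Cc : Type
  | var : Nat → Cc
  | srt : Srt → Cc
  | pi  : Srt → Cc → Cc → Cc
  | lam : Srt → Cc → Cc → Cc
  | app : Cc → Cc → Cc
  | cst : Cc

namespace Cc

def rename (ξ : Nat → Nat) : Cc → Cc
  | var x => var (ξ x)
  | srt s => srt s
  | pi t A B => pi t (rename ξ A) (rename (upr ξ) B)
  | lam t A m => lam t (rename ξ A) (rename (upr ξ) m)
  | app m n => app (rename ξ m) (rename ξ n)
  | cst => cst

def up (σ : Nat → Cc) : Nat → Cc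
  | 0 => var 0
  | n + 1 => rename Nat.succ (σ n)

def subst (σ : Nat → Cc) : Cc → Cc
  | var x => σ x
  | srt s => srt s
  | pi t A B => pi t (subst σ A) (subst (up σ) B)
  | lam t A m => lam t (subst σ A) (subst (up σ) m)
  | app m n => app (subst σ m) (subst σ n)
  | cst => cst

/-- The substitution sending the topmost variable to `n`. -/
def single (n : Cc) : Nat → Cc
  | 0 => n
  | i + 1 => var i

/-- `inst n m` is `m[n/x]` for the topmost bound variable `x`. -/
def inst (n m : Cc) : Cc := subst (single n) m

/-! ### Substitution algebra -/

theorem upr_comp (ξ ζ : Nat → Nat) : upr ξ ∘ upr ζ = upr (ξ ∘ ζ) := by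
  funext x; cases x <;> rfl

theorem rename_rename (m : Cc) (ξ ζ : Nat → Nat) :
    rename ξ (rename ζ m) = rename (ξ ∘ ζ) m := by
  induction m generalizing ξ ζ <;> simp_all [rename, upr_comp]

theorem up_comp_upr (σ : Nat → Cc) (ξ : Nat → Nat) : up σ ∘ upr ξ = up (σ ∘ ξ) := by
  funext x; cases x <;> rfl

theorem subst_rename (m : Cc) (σ : Nat → Cc) (ξ : Nat → Nat) :
    subst σ (rename ξ m) = subst (σ ∘ ξ) m := by
  induction m generalizing σ ξ <;> simp_all [rename, subst, up_comp_upr]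

theorem rename_comp_up (ξ : Nat → Nat) (σ : Nat → Cc) :
    rename (upr ξ) ∘ up σ = up (rename ξ ∘ σ) := by
  funext x
  cases x with
  | zero => rfl
  | succ n => simp only [Function.comp, up, rename_rename]; rfl

theorem rename_subst (m : Cc) (ξ : Nat → Nat) (σ : Nat → Cc) :
    rename ξ (subst σ m) = subst (rename ξ ∘ σ) m := by
  induction m generalizing σ ξ <;> simp_all [rename, subst, rename_comp_up]

theorem subst_comp_up (σ τ : Nat → Cc) : subst (up σ) ∘ up τ = up (subst σ ∘ τ) := by
  funext x
  cases x with
  | zero => rfl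
  | succ n => simp only [Function.comp, up, subst_rename, rename_subst]; rfl

theorem subst_subst (m : Cc) (σ τ : Nat → Cc) :
    subst σ (subst τ m) = subst (subst σ ∘ τ) m := by
  induction m generalizing σ τ <;> simp_all [subst, subst_comp_up]

theorem up_var : up var = var := by
  funext x; cases x <;> rfl

theorem subst_var (m : Cc) : subst var m = m := by
  induction m <;> simp_all [subst, up_var]

theorem up_var_comp (ξ : Nat → Nat) : up (var ∘ ξ) = var ∘ upr ξ := by
  funext x; cases x <;> rfl

theorem rename_eq_subst (m : Cc) (ξ : Nat → Nat) : rename ξ m = subst (var ∘ ξ) m := by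
  induction m generalizing ξ <;> simp_all [rename, subst, up_var_comp]

theorem inst_rename_succ (n m : Cc) : inst n (rename Nat.succ m) = m := by
  rw [inst, subst_rename]; exact subst_var m

theorem subst_inst (σ : Nat → Cc) (n m : Cc) :
    subst σ (inst n m) = inst (subst σ n) (subst (up σ) m) := by
  simp only [inst, subst_subst]
  congr 1
  funext x
  cases x with
  | zero => rfl
  | succ k => exact (inst_rename_succ _ _).symm

theorem rename_inst (ξ : Nat → Nat) (n m : Cc) :
    rename ξ (inst n m) = inst (rename ξ n) (rename (upr ξ) m) := by
  simp only [rename_eq_subst, subst_inst, up_var_comp]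

/-! ### Parallel reduction and confluence -/

/-- Parallel β-reduction. -/
inductive Par : Cc → Cc → Prop
  | var {x} : Par (var x) (var x)
  | srt {s} : Par (srt s) (srt s)
  | cst : Par cst cst
  | pi {t A A' B B'} : Par A A' → Par B B' → Par (pi t A B) (pi t A' B')
  | lam {t A A' m m'} : Par A A' → Par m m' → Par (lam t A m) (lam t A' m')
  | app {m m' n n'} : Par m m' → Par n n' → Par (app m n) (app m' n')
  | beta {t A m m' n n'} : Par m m' → Par n n' → Par (app (lam t A m) n) (inst n' m')

theorem Par.refl (m : Cc) : Par m m := by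
  induction m <;> constructor <;> assumption

theorem Par.rename {m m' : Cc} (h : Par m m') (ξ : Nat → Nat) :
    Par (m.rename ξ) (m'.rename ξ) := by
  induction h generalizing ξ with
  | beta _ _ ih₁ ih₂ => rw [rename_inst]; exact .beta (ih₁ _) (ih₂ _)
  | _ => constructor <;> apply_assumption

theorem Par.up {σ τ : Nat → Cc} (h : ∀ x, Par (σ x) (τ x)) (x : Nat) :
    Par (up σ x) (up τ x) := by
  cases x with
  | zero => exact .var
  | succ n => exact (h n).rename _

theorem Par.subst {m m' : Cc} (h : Par m m') {σ τ : Nat → Cc}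
    (hσ : ∀ x, Par (σ x) (τ x)) : Par (m.subst σ) (m'.subst τ) := by
  induction h generalizing σ τ with
  | var => exact hσ _
  | srt => exact .srt
  | cst => exact .cst
  | pi _ _ ih₁ ih₂ => exact .pi (ih₁ hσ) (ih₂ (Par.up hσ))
  | lam _ _ ih₁ ih₂ => exact .lam (ih₁ hσ) (ih₂ (Par.up hσ))
  | app _ _ ih₁ ih₂ => exact .app (ih₁ hσ) (ih₂ hσ)
  | beta _ _ ih₁ ih₂ => rw [subst_inst]; exact .beta (ih₁ (Par.up hσ)) (ih₂ hσ)

theorem Par.inst {m m' n n' : Cc} (hm : Par m m') (hn : Par n n') :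
    Par (inst n m) (inst n' m') := by
  refine hm.subst fun x => ?_
  cases x with
  | zero => exact hn
  | succ => exact .var

/-- Complete development: contract all redexes simultaneously. -/
def develop : Cc → Cc
  | var x => var x
  | srt s => srt s
  | pi t A B => pi t (develop A) (develop B)
  | lam t A m => lam t (develop A) (develop m)
  | app (lam _ _ m) n => inst (develop n) (develop m)
  | app m n => app (develop m) (develop n)
  | cst => cst

theorem Par.develop {m m' : Cc} (h : Par m m') : Par m' (develop m) := by
  induction h with
  | @app m m' n n' hm _ ih₁ ih₂ =>
    cases m with
    | lam t A b =>
      cases hm with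
      | lam =>
        cases ih₁ with
        | lam _ ih => exact .beta ih ih₂
    | _ => exact .app ih₁ ih₂
  | beta _ _ ih₁ ih₂ => exact ih₁.inst ih₂
  | _ => constructor <;> assumption

/-- Iterated parallel reduction. -/
abbrev Red : Cc → Cc → Prop := Relation.ReflTransGen Par

/-- Convertibility. -/
def Cnv (A B : Cc) : Prop := Relation.Join Red A B

theorem Cnv.refl (A : Cc) : Cnv A A := ⟨A, .refl, .refl⟩

theorem Cnv.symm {A B : Cc} : Cnv A B → Cnv B A
  | ⟨C, h₁, h₂⟩ => ⟨C, h₂, h₁⟩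

theorem Red.confluent {A B C : Cc} (h₁ : Red A B) (h₂ : Red A C) : Cnv B C :=
  Relation.church_rosser
    (fun a _ _ hb hc => ⟨develop a, .single hb.develop, .single hc.develop⟩) h₁ h₂

theorem Cnv.trans {A B C : Cc} : Cnv A B → Cnv B C → Cnv A C
  | ⟨_, h₁, h₂⟩, ⟨_, h₃, h₄⟩ =>
    have ⟨E, h₅, h₆⟩ := h₂.confluent h₃
    ⟨E, h₁.trans h₅, h₄.trans h₆⟩

theorem Par.cnv {A B : Cc} (h : Par A B) : Cnv A B := ⟨B, .single h, .refl⟩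

theorem Cnv.lift {f : Cc → Cc} (hf : ∀ {a b}, Par a b → Par (f a) (f b)) {A B : Cc} :
    Cnv A B → Cnv (f A) (f B)
  | ⟨C, h₁, h₂⟩ => ⟨f C, h₁.lift f fun _ _ => hf, h₂.lift f fun _ _ => hf⟩

theorem Cnv.subst {A B : Cc} (h : Cnv A B) (σ : Nat → Cc) : Cnv (A.subst σ) (B.subst σ) :=
  h.lift fun h => h.subst fun _ => .refl _

theorem Cnv.rename {A B : Cc} (h : Cnv A B) (ξ : Nat → Nat) : Cnv (A.rename ξ) (B.rename ξ) :=
  h.lift fun h => h.rename ξ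

theorem Cnv.pi {t : Srt} {A A' B B' : Cc} (hA : Cnv A A') (hB : Cnv B B') :
    Cnv (pi t A B) (pi t A' B') :=
  (hA.lift (f := fun A => Cc.pi t A B) fun h => .pi h (.refl _)).trans
    (hB.lift fun h => .pi (.refl _) h)

theorem Red.srt_inv {s : Srt} {A : Cc} (h : Red (srt s) A) : A = srt s := by
  induction h with
  | refl => rfl
  | tail _ h ih => subst ih; cases h; rfl

theorem Red.pi_inv {t : Srt} {A B C : Cc} (h : Red (pi t A B) C) :
    ∃ A' B', C = Cc.pi t A' B' ∧ Red A A' ∧ Red B B' := by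
  induction h with
  | refl => exact ⟨A, B, rfl, .refl, .refl⟩
  | tail _ h ih =>
    obtain ⟨A', B', rfl, hA, hB⟩ := ih
    cases h with
    | pi h₁ h₂ => exact ⟨_, _, rfl, hA.tail h₁, hB.tail h₂⟩

theorem Cnv.srt_inj {s r : Srt} : Cnv (srt s) (srt r) → s = r
  | ⟨_, h₁, h₂⟩ => by cases h₁.srt_inv.symm.trans h₂.srt_inv; rfl

theorem Cnv.pi_inj {t r : Srt} {A A' B B' : Cc} :
    Cnv (Cc.pi t A B) (Cc.pi r A' B') → Cnv A A' ∧ Cnv B B'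
  | ⟨_, h₁, h₂⟩ => by
    obtain ⟨C, D, rfl, hA, hB⟩ := h₁.pi_inv
    obtain ⟨_, _, h, hA', hB'⟩ := h₂.pi_inv
    cases h
    exact ⟨⟨_, hA, hA'⟩, ⟨_, hB, hB'⟩⟩

/-! ### Typing -/

/-- Variable lookup. -/
inductive In : List Cc → Nat → Cc → Prop
  | zero {Γ A} : In (A :: Γ) 0 (rename Nat.succ A)
  | succ {Γ x A B} : In Γ x A → In (B :: Γ) (x + 1) (rename Nat.succ A)

/-- Typing without well-formedness of contexts. -/
inductive Ty : List Cc → Cc → Cc → Prop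
  | srt {Γ} (s : Srt) : Ty Γ (srt s) (srt .U)
  | var {Γ x A} : In Γ x A → Ty Γ (var x) A
  | pi {Γ A B s r} (t : Srt) :
      Ty Γ A (.srt s) → Ty (A :: Γ) B (.srt r) → Ty Γ (pi t A B) (.srt t)
  | lam {Γ A B m s} (t : Srt) :
      Ty Γ A (.srt s) → Ty (A :: Γ) m B → Ty Γ (lam t A m) (.pi t A B)
  | app {Γ m n A B t} : Ty Γ m (.pi t A B) → Ty Γ n A → Ty Γ (app m n) (inst n B)
  | conv {Γ m A B s} : Ty Γ m A → Ty Γ B (.srt s) → Cnv A B → Ty Γ m B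

/-- Well-formed contexts. -/
inductive Wf : List Cc → Prop
  | nil : Wf []
  | cons {Γ A s} : Wf Γ → Ty Γ A (.srt s) → Wf (A :: Γ)

theorem In.unique {Γ : List Cc} {x : Nat} {A B : Cc} (h : In Γ x A) (h' : In Γ x B) :
    A = B := by
  induction h generalizing B with
  | zero => cases h'; rfl
  | succ _ ih => cases h' with | succ h' => rw [ih h']

theorem Ty.rename {Γ Δ : List Cc} {m A : Cc} (h : Ty Γ m A) {ξ : Nat → Nat}
    (hξ : ∀ x B, In Γ x B → In Δ (ξ x) (B.rename ξ)) : Ty Δ (m.rename ξ) (A.rename ξ) := by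
  have lift {Γ Δ : List Cc} {ξ : Nat → Nat} (A : Cc)
      (hξ : ∀ x B, In Γ x B → In Δ (ξ x) (B.rename ξ)) (x : Nat) (B : Cc)
      (h : In (A :: Γ) x B) : In (A.rename ξ :: Δ) (upr ξ x) (B.rename (upr ξ)) := by
    cases h with
    | zero =>
      have := In.zero (Γ := Δ) (A := A.rename ξ)
      rw [rename_rename] at this ⊢; exact this
    | succ h =>
      have := In.succ (B := A.rename ξ) (hξ _ _ h)
      rw [rename_rename] at this ⊢; exact this
  induction h generalizing Δ ξ with
  | srt s => exact .srt s
  | var h => exact .var (hξ _ _ h)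
  | pi t _ _ ih₁ ih₂ => exact .pi t (ih₁ hξ) (ih₂ (lift _ hξ))
  | lam t _ _ ih₁ ih₂ => exact .lam t (ih₁ hξ) (ih₂ (lift _ hξ))
  | app _ _ ih₁ ih₂ => rw [rename_inst]; exact .app (ih₁ hξ) (ih₂ hξ)
  | conv _ _ h ih₁ ih₂ => exact .conv (ih₁ hξ) (ih₂ hξ) (h.rename ξ)

theorem Ty.weaken {Γ : List Cc} {m A : Cc} (h : Ty Γ m A) (B : Cc) :
    Ty (B :: Γ) (m.rename Nat.succ) (A.rename Nat.succ) :=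
  h.rename fun _ _ h => .succ h

theorem Ty.subst {Γ Δ : List Cc} {m A : Cc} (h : Ty Γ m A) {σ : Nat → Cc}
    (hσ : ∀ x B, In Γ x B → Ty Δ (σ x) (B.subst σ)) : Ty Δ (m.subst σ) (A.subst σ) := by
  have lift {Γ Δ : List Cc} {σ : Nat → Cc} (A : Cc)
      (hσ : ∀ x B, In Γ x B → Ty Δ (σ x) (B.subst σ)) (x : Nat) (B : Cc)
      (h : In (A :: Γ) x B) : Ty (A.subst σ :: Δ) (up σ x) (B.subst (up σ)) := by
    cases h with
    | zero =>
      have := In.zero (Γ := Δ) (A := A.subst σ)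
      rw [rename_subst] at this
      rw [subst_rename]; exact .var this
    | succ h =>
      have := (hσ _ _ h).weaken (A.subst σ)
      rw [rename_subst] at this
      rw [subst_rename]; exact this
  induction h generalizing Δ σ with
  | srt s => exact .srt s
  | var h => exact hσ _ _ h
  | pi t _ _ ih₁ ih₂ => exact .pi t (ih₁ hσ) (ih₂ (lift _ hσ))
  | lam t _ _ ih₁ ih₂ => exact .lam t (ih₁ hσ) (ih₂ (lift _ hσ))
  | app _ _ ih₁ ih₂ => rw [subst_inst]; exact .app (ih₁ hσ) (ih₂ hσ)
  | conv _ _ h ih₁ ih₂ => exact .conv (ih₁ hσ) (ih₂ hσ) (h.subst σ)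

theorem Ty.inst {Γ : List Cc} {m n A B : Cc} (h : Ty (A :: Γ) m B) (hn : Ty Γ n A) :
    Ty Γ (inst n m) (inst n B) := by
  refine h.subst fun x C hC => ?_
  cases hC with
  | zero => exact (inst_rename_succ n A).substr (p := Ty Γ n) hn
  | @succ _ x C _ hC => exact (inst_rename_succ n C).substr (p := Ty Γ (.var x)) (.var hC)

theorem Ty.conv_ctx {Γ : List Cc} {m A A' B : Cc} {s : Srt} (h : Ty (A :: Γ) m B)
    (hA : Ty Γ A (.srt s)) (hc : Cnv A' A) : Ty (A' :: Γ) m B := by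
  rw [← subst_var m, ← subst_var B]
  refine h.subst fun x C hC => ?_
  rw [subst_var]
  cases hC with
  | zero => exact .conv (.var .zero) (hA.weaken A') (hc.rename _)
  | succ hC => exact .var (.succ hC)

theorem Ty.srt_inv {Γ : List Cc} {s : Srt} {C : Cc} (h : Ty Γ (.srt s) C) :
    Cnv (.srt .U) C := by
  generalize hm : Cc.srt s = m at h
  induction h with
  | srt => exact .refl _
  | conv _ _ h ih => exact (ih hm).trans h
  | _ => cases hm

theorem Ty.var_inv {Γ : List Cc} {x : Nat} {C : Cc} (h : Ty Γ (.var x) C) :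
    ∃ A, In Γ x A ∧ Cnv A C := by
  generalize hm : Cc.var x = m at h
  induction h with
  | var h => cases hm; exact ⟨_, h, .refl _⟩
  | conv _ _ h ih => obtain ⟨A, h₁, h₂⟩ := ih hm; exact ⟨A, h₁, h₂.trans h⟩
  | _ => cases hm

theorem Ty.pi_inv {Γ : List Cc} {t : Srt} {A B C : Cc} (h : Ty Γ (.pi t A B) C) :
    ∃ s r, Ty Γ A (.srt s) ∧ Ty (A :: Γ) B (.srt r) ∧ Cnv (.srt t) C := by
  generalize hm : Cc.pi t A B = m at h
  induction h with
  | pi _ h₁ h₂ => cases hm; exact ⟨_, _, h₁, h₂, .refl _⟩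
  | conv _ _ h ih =>
    obtain ⟨s, r, h₁, h₂, h₃⟩ := ih hm; exact ⟨s, r, h₁, h₂, h₃.trans h⟩
  | _ => cases hm

theorem Ty.lam_inv {Γ : List Cc} {t : Srt} {A m C : Cc} (h : Ty Γ (.lam t A m) C) :
    ∃ s B, Ty Γ A (.srt s) ∧ Ty (A :: Γ) m B ∧ Cnv (.pi t A B) C := by
  generalize hm : Cc.lam t A m = m' at h
  induction h with
  | lam _ h₁ h₂ => cases hm; exact ⟨_, _, h₁, h₂, .refl _⟩
  | conv _ _ h ih =>
    obtain ⟨s, r, h₁, h₂, h₃⟩ := ih hm; exact ⟨s, r, h₁, h₂, h₃.trans h⟩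
  | _ => cases hm

theorem Ty.app_inv {Γ : List Cc} {m n C : Cc} (h : Ty Γ (.app m n) C) :
    ∃ t A B, Ty Γ m (.pi t A B) ∧ Cnv (Cc.inst n B) C := by
  generalize hm : Cc.app m n = m' at h
  induction h with
  | app h => cases hm; exact ⟨_, _, _, h, .refl _⟩
  | conv _ _ h ih => obtain ⟨t, A, B, h₁, h₂⟩ := ih hm; exact ⟨t, A, B, h₁, h₂.trans h⟩
  | _ => cases hm

theorem Ty.unique {Γ : List Cc} {m A B : Cc} (h : Ty Γ m A) (h' : Ty Γ m B) : Cnv A B := by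
  induction h generalizing B with
  | srt => exact h'.srt_inv
  | var h => obtain ⟨C, hC, hc⟩ := h'.var_inv; exact h.unique hC ▸ hc
  | pi => obtain ⟨_, _, _, _, hc⟩ := h'.pi_inv; exact hc
  | lam _ _ _ _ ih =>
    obtain ⟨_, _, _, h, hc⟩ := h'.lam_inv
    exact (Cnv.pi (.refl _) (ih h)).trans hc
  | app _ _ ih =>
    obtain ⟨_, _, _, h, hc⟩ := h'.app_inv
    exact ((ih h).pi_inj.2.subst _).trans hc
  | conv _ _ h ih => exact h.symm.trans (ih h')

theorem In.valid {Γ : List Cc} {x : Nat} {A : Cc} (h : In Γ x A) (hΓ : Wf Γ) :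
    ∃ s, Ty Γ A (.srt s) := by
  induction h with
  | zero => cases hΓ with | cons _ h => exact ⟨_, h.weaken _⟩
  | succ _ ih =>
    cases hΓ with
    | cons hΓ _ => obtain ⟨s, h⟩ := ih hΓ; exact ⟨s, h.weaken _⟩

theorem Ty.valid {Γ : List Cc} {m A : Cc} (h : Ty Γ m A) (hΓ : Wf Γ) :
    ∃ s, Ty Γ A (.srt s) := by
  induction h with
  | srt => exact ⟨_, .srt _⟩
  | var h => exact h.valid hΓ
  | pi => exact ⟨_, .srt _⟩
  | lam t hA _ _ ih => obtain ⟨r, h⟩ := ih (hΓ.cons hA); exact ⟨t, .pi t hA h⟩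
  | app _ hn ih =>
    obtain ⟨_, h⟩ := ih hΓ
    obtain ⟨_, r, _, hB, _⟩ := h.pi_inv
    exact ⟨r, hB.inst hn⟩
  | conv _ h => exact ⟨_, h⟩

theorem Ty.par {Γ : List Cc} {m m' A : Cc} (h : Ty Γ m A) (hΓ : Wf Γ) (hp : Par m m') :
    Ty Γ m' A := by
  induction h generalizing m' with
  | srt s => cases hp; exact .srt s
  | var h => cases hp; exact .var h
  | pi t hA _ ih₁ ih₂ =>
    cases hp with
    | pi pA pB => exact .pi t (ih₁ hΓ pA) ((ih₂ (hΓ.cons hA) pB).conv_ctx hA pA.cnv.symm)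
  | lam t hA hm ih₁ ih₂ =>
    cases hp with
    | lam pA pm =>
      obtain ⟨_, hB⟩ := hm.valid (hΓ.cons hA)
      exact .conv (.lam t (ih₁ hΓ pA) ((ih₂ (hΓ.cons hA) pm).conv_ctx hA pA.cnv.symm))
        (.pi t hA hB) (.pi pA.cnv.symm (.refl _))
  | app hm hn ih₁ ih₂ =>
    obtain ⟨_, hP⟩ := hm.valid hΓ
    obtain ⟨_, _, _, hB, _⟩ := hP.pi_inv
    cases hp with
    | app pm pn =>
      exact .conv (.app (ih₁ hΓ pm) (ih₂ hΓ pn)) (hB.inst hn) ((Par.refl _).inst pn).cnv.symm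
    | beta pm pn =>
      obtain ⟨_, _, hA, hm', hc⟩ := (ih₁ hΓ (.lam (.refl _) pm)).lam_inv
      obtain ⟨hcA, hcB⟩ := hc.pi_inj
      exact .conv (hm'.inst (.conv (ih₂ hΓ pn) hA hcA.symm)) (hB.inst hn)
        ((hcB.subst _).trans ((Par.refl _).inst pn).cnv.symm)
  | conv _ hB hc ih => exact .conv (ih hΓ hp) hB hc

theorem Ty.red {Γ : List Cc} {m m' A : Cc} (h : Ty Γ m A) (hΓ : Wf Γ) (hr : Red m m') :
    Ty Γ m' A := by
  induction hr with
  | refl => exact h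
  | tail _ hp ih => exact ih.par hΓ hp

/-- Convertible types have the same sort. -/
theorem Ty.sort_unique {Γ : List Cc} {A B : Cc} {s r : Srt} (hA : Ty Γ A (.srt s))
    (hB : Ty Γ B (.srt r)) (hΓ : Wf Γ) : Cnv A B → s = r
  | ⟨_, h₁, h₂⟩ => ((hA.red hΓ h₁).unique (hB.red hΓ h₂)).srt_inj

end Cc

/-! ### Forgetting relevance -/

/-- Forget the relevance annotations of a term. -/
def forget : Tm → Cc
  | .var x => .var x
  | .srt s => .srt s
  | .pi0 t A B => .pi t (forget A) (forget B)
  | .pi1 t A B => .pi t (forget A) (forget B)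
  | .lam0 t A m => .lam t (forget A) (forget m)
  | .lam1 t A m => .lam t (forget A) (forget m)
  | .app m n => .app (forget m) (forget n)
  | .box => .cst
  | .ptr _ => .cst

theorem forget_rename (m : Tm) (ξ : Nat → Nat) :
    forget (rename ξ m) = (forget m).rename ξ := by
  induction m generalizing ξ <;> simp_all [rename, forget, Cc.rename]

theorem forget_comp_up (σ : Nat → Tm) : Cc.up (forget ∘ σ) = forget ∘ up σ := by
  funext x
  cases x with
  | zero => rfl
  | succ n => exact (forget_rename _ _).symm

theorem forget_subst (m : Tm) (σ : Nat → Tm) :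
    forget (subst σ m) = (forget m).subst (forget ∘ σ) := by
  induction m generalizing σ <;> simp_all [subst, forget, Cc.subst, forget_comp_up]

theorem forget_subst1 (n m : Tm) : forget (subst1 n m) = Cc.inst (forget n) (forget m) := by
  rw [subst1, forget_subst, Cc.inst]
  congr 1
  funext x; cases x <;> rfl

theorem LStep.forget_par {A B : Tm} (h : LStep A B) : Cc.Par (forget A) (forget B) := by
  induction h with
  | beta0 | beta1 => rw [forget_subst1]; exact .beta (.refl _) (.refl _)
  | _ => constructor <;> first | assumption | exact .refl _

theorem Conv.forget_cnv {A B : Tm} (h : Conv A B) : Cc.Cnv (forget A) (forget B) := by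
  induction h with
  | rel _ _ h => exact h.forget_par.cnv
  | refl => exact .refl _
  | symm _ _ _ ih => exact ih.symm
  | trans _ _ _ _ _ ih₁ ih₂ => exact ih₁.trans ih₂

theorem Has.forget_in {Γ : Ctx} {x : Nat} {A : Tm} (h : Has Γ x A) :
    Cc.In (Γ.map forget) x (forget A) := by
  induction h with
  | zero => rw [forget_rename]; exact .zero
  | succ _ ih => rw [forget_rename]; exact .succ ih

theorem LTyped.forget_ty_wf {Γ : Ctx} {m A : Tm} (h : LTyped Γ m A) :
    Cc.Ty (Γ.map forget) (forget m) (forget A) ∧ Cc.Wf (Γ.map forget) := by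
  refine LTyped.rec (motive_1 := fun Γ _ => Cc.Wf (Γ.map forget))
    (motive_2 := fun Γ m A _ =>
      Cc.Ty (Γ.map forget) (forget m) (forget A) ∧ Cc.Wf (Γ.map forget))
    .nil (fun _ _ h₁ h₂ => h₁.cons h₂.1) (fun s _ h => ⟨.srt s, h⟩)
    (fun _ hx h => ⟨.var hx.forget_in, h⟩)
    (fun t _ _ h₁ h₂ => ⟨.pi t h₁.1 h₂.1, h₁.2⟩)
    (fun t _ _ h₁ h₂ => ⟨.pi t h₁.1 h₂.1, h₁.2⟩)
    ?_ ?_ ?_ ?_ (fun _ _ hc h₁ h₂ => ⟨.conv h₁.1 h₂.1 hc.forget_cnv, h₁.2⟩) h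
  · rintro Γ A B m t - ⟨h, hΓ⟩
    cases hΓ with | cons hΓ hA => exact ⟨.lam t hA h, hΓ⟩
  · rintro Γ A B m t - ⟨h, hΓ⟩
    cases hΓ with | cons hΓ hA => exact ⟨.lam t hA h, hΓ⟩
  · rintro Γ m n A B t - - ⟨h₁, hΓ⟩ ⟨h₂, -⟩
    exact ⟨forget_subst1 n B ▸ .app h₁ h₂, hΓ⟩
  · rintro Γ m n A B t - - ⟨h₁, hΓ⟩ ⟨h₂, -⟩
    exact ⟨forget_subst1 n B ▸ .app h₁ h₂, hΓ⟩

theorem PWf.forget_wf {Γ : Ctx} {Δ : PCtx} (h : PWf Γ Δ) : Cc.Wf (Γ.map forget) := by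
  induction h with
  | nil => exact .nil
  | cons _ hA ih | consN _ hA ih => exact ih.cons hA.forget_ty_wf.1

theorem PHas.forget_in {Γ : Ctx} {Δ : PCtx} {x : Nat} {s : Srt} {A : Tm} (h : PHas Δ x s A)
    (hΓ : PWf Γ Δ) : Cc.In (Γ.map forget) x (forget A) := by
  induction h generalizing Γ with
  | zero => cases hΓ; rw [forget_rename]; exact .zero
  | succN _ ih | succU _ ih =>
    cases hΓ; rw [forget_rename]; exact .succ (ih ‹_›)

theorem PHas.forget_sort {Γ : Ctx} {Δ : PCtx} {x : Nat} {s : Srt} {A : Tm} (h : PHas Δ x s A)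
    (hΓ : PWf Γ Δ) : Cc.Ty (Γ.map forget) (forget A) (.srt s) := by
  induction h generalizing Γ with
  | zero =>
    cases hΓ with | cons _ hA => rw [forget_rename]; exact hA.forget_ty_wf.1.weaken _
  | succN _ ih | succU _ ih =>
    cases hΓ; rw [forget_rename]; exact (ih ‹_›).weaken _

theorem PTyped.forget_ty_wf {Γ : Ctx} {Δ : PCtx} {m A : Tm} (h : PTyped Γ Δ m A) :
    Cc.Ty (Γ.map forget) (forget m) (forget A) ∧ Cc.Wf (Γ.map forget) := by
  induction h with
  | var hΓ hx => exact ⟨.var (hx.forget_in hΓ), hΓ.forget_wf⟩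
  | lam0 t _ _ ih | lam1 t _ _ ih =>
    obtain ⟨h, hΓ⟩ := ih
    cases hΓ with | cons hΓ hA => exact ⟨.lam t hA h, hΓ⟩
  | app0 _ hn ih => exact ⟨forget_subst1 _ _ ▸ .app ih.1 hn.forget_ty_wf.1, ih.2⟩
  | app1 _ _ _ ih₁ ih₂ => exact ⟨forget_subst1 _ _ ▸ .app ih₁.1 ih₂.1, ih₁.2⟩
  | conv _ hB hc ih => exact ⟨.conv ih.1 hB.forget_ty_wf.1 hc.forget_cnv, ih.2⟩

theorem restr_L (Δ : PCtx) : Restr Δ .L := by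
  induction Δ with
  | nil => exact .nil
  | cons e _ ih =>
    cases e with
    | none => exact .skip ih
    | some => exact .l ih

theorem PHas.restr {Δ : PCtx} {x : Nat} {s : Srt} {A : Tm} (h : PHas Δ x s A) :
    Restr Δ s := by
  cases s with
  | L => exact restr_L Δ
  | U =>
    generalize hs : Srt.U = s at h
    induction h with
    | zero h => subst hs; exact .u h
    | succN _ ih => exact .skip (ih hs)
    | succU _ ih => subst hs; exact .u (ih rfl)

/-- Value stability. -/
theorem value_stability {Γ : Ctx} {Δ : PCtx} {v A : Tm} {s : Srt}
    (hv : Value v) (h : PTyped Γ Δ v A) (hA : LTyped Γ A (.srt s)) :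
    Restr Δ s := by
  replace hA := hA.forget_ty_wf.1
  induction h generalizing s with
  | var hΓ hx =>
    cases (hx.forget_sort hΓ).sort_unique hA hΓ.forget_wf (.refl _)
    exact hx.restr
  | lam0 _ _ hr | lam1 _ _ hr =>
    obtain ⟨_, _, _, _, hc⟩ := hA.pi_inv
    cases hc.srt_inj
    exact hr
  | app0 | app1 => cases hv
  | conv h _ hc ih =>
    obtain ⟨h, hΓ⟩ := h.forget_ty_wf
    obtain ⟨r, hr⟩ := h.valid hΓ
    cases hr.sort_unique hA hΓ hc.forget_cnv
    exact ih hv hr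

end TLL
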